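/- L∞_h L²_z bound for u^r with tangential Sobolev loss: for every λ ∈ [0,1) there exists a constant C > 0, depending only on λ, such that for every t ≥ 0, every admissible g, and every n ∈ ℕ: ∑_{|α|=n} ‖θ_λ ⟨r⟩ⁿ ∂^α_h u^r‖_{L^∞_h L²_z} ≤ C (n+1)² ∑_{α : n ≤ |α| ≤ n+2} ‖θ ⟨r⟩^{|α|} ∂^α_h g‖_{L²}. -/

import Mathlib

open MeasureTheory Filter Set

noncomputable section

/-- `⟨t⟩ = 1 + t` -/
def angT (t : ℝ) : ℝ := 1 + t

/-- `θ_λ(z) = exp (λ z² / (8⟨t⟩))`; `θ = θ₁`. -/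
def thw (t lam z : ℝ) : ℝ := Real.exp (lam * z ^ 2 / (8 * angT t))

/-- `⟨r⟩ = √(x² + y² + 1)` -/
def angR (x y : ℝ) : ℝ := Real.sqrt (x ^ 2 + y ^ 2 + 1)

/-- `Mₙ = (n+1)⁴ / n!` -/
def Mfac (n : ℕ) : ℝ := ((n : ℝ) + 1) ^ 4 / (n.factorial : ℝ)

/-- `∂_x` -/
def pdx (f : ℝ → ℝ → ℝ → ℝ) : ℝ → ℝ → ℝ → ℝ := fun x y z => deriv (fun x' => f x' y z) x
/-- `∂_y` -/
def pdy (f : ℝ → ℝ → ℝ → ℝ) : ℝ → ℝ → ℝ → ℝ := fun x y z => deriv (fun y' => f x y' z) y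
/-- `∂_z` -/
def pdz (f : ℝ → ℝ → ℝ → ℝ) : ℝ → ℝ → ℝ → ℝ := fun x y z => deriv (fun z' => f x y z') z

/-- `∂^α_h = ∂_x^{α₁} ∂_y^{α₂}` for the multi-index `α = (a, b)` -/
def pdh (a b : ℕ) (f : ℝ → ℝ → ℝ → ℝ) : ℝ → ℝ → ℝ → ℝ := pdx^[a] (pdy^[b] f)

/-- `r ∂_r = x ∂_x + y ∂_y` -/
def rdr (f : ℝ → ℝ → ℝ → ℝ) : ℝ → ℝ → ℝ → ℝ := fun x y z => x * pdx f x y z + y * pdy f x y z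

/-- weighted `L²` norm over `ℝ² × (0,∞)` of `θ_λ ⟨r⟩ⁿ f` -/
def L2w (t lam : ℝ) (n : ℕ) (f : ℝ → ℝ → ℝ → ℝ) : ℝ :=
  Real.sqrt (∫ x : ℝ, ∫ y : ℝ, ∫ z in Ioi (0 : ℝ), (thw t lam z * angR x y ^ n * f x y z) ^ 2)

/-- weighted `L²_z` norm at fixed `(x, y)` of `θ_λ ⟨r⟩ⁿ f (x, y, ·)` -/
def L2z (t lam : ℝ) (n : ℕ) (f : ℝ → ℝ → ℝ → ℝ) (x y : ℝ) : ℝ :=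
  Real.sqrt (∫ z in Ioi (0 : ℝ), (thw t lam z * angR x y ^ n * f x y z) ^ 2)

/-- mixed `L^∞_h L²_z` norm of `θ_λ ⟨r⟩ⁿ f` -/
def LIh2z (t lam : ℝ) (n : ℕ) (f : ℝ → ℝ → ℝ → ℝ) : ℝ :=
  Real.sqrt (∫ z in Ioi (0 : ℝ), (⨆ p : ℝ × ℝ, |thw t lam z * angR p.1 p.2 ^ n * f p.1 p.2 z|) ^ 2)

/-- mixed `L²_h L^∞_z` norm of `θ_λ ⟨r⟩ⁿ f` -/
def L2hIz (t lam : ℝ) (n : ℕ) (f : ℝ → ℝ → ℝ → ℝ) : ℝ :=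
  Real.sqrt (∫ x : ℝ, ∫ y : ℝ,
    (⨆ z : Ioi (0 : ℝ), |thw t lam (z : ℝ) * angR x y ^ n * f x y (z : ℝ)|) ^ 2)

/-- the primitive `φ(x,y,z) = exp(−z²/(4⟨t⟩)) ∫₀^z g(x,y,s) exp(s²/(4⟨t⟩)) ds` -/
def phiF (t : ℝ) (g : ℝ → ℝ → ℝ → ℝ) : ℝ → ℝ → ℝ → ℝ := fun x y z =>
  Real.exp (-(z ^ 2) / (4 * angT t)) * ∫ s in (0 : ℝ)..z, g x y s * Real.exp (s ^ 2 / (4 * angT t))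

/-- `u^r = ∂_z φ` -/
def ur (t : ℝ) (g : ℝ → ℝ → ℝ → ℝ) : ℝ → ℝ → ℝ → ℝ := pdz (phiF t g)

/-- `u^z = −(x∂_x + y∂_y)φ − 2φ` -/
def uzv (t : ℝ) (g : ℝ → ℝ → ℝ → ℝ) : ℝ → ℝ → ℝ → ℝ := fun x y z =>
  -(rdr (phiF t g) x y z) - 2 * phiF t g x y z

/-- smoothness together with rapid decay in `z` of all derivatives -/
def DecaySmooth (g : ℝ → ℝ → ℝ → ℝ) : Prop :=
  ContDiff ℝ (⊤ : ℕ∞) (fun p : ℝ × ℝ × ℝ => g p.1 p.2.1 p.2.2) ∧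
  ∀ a b k m : ℕ, ∀ x y : ℝ,
    Tendsto (fun z : ℝ => z ^ m * pdz^[k] (pdh a b g) x y z) atTop (nhds 0)

/-- `θ ⟨r⟩^{|α|} ∂^α_h g ∈ L²(ℝ² × (0,∞))` for every `α` -/
def L2cond (t : ℝ) (g : ℝ → ℝ → ℝ → ℝ) : Prop :=
  ∀ a b : ℕ,
    Integrable
      (fun p : ℝ × ℝ × ℝ =>
        (thw t 1 p.2.2 * angR p.1 p.2.1 ^ (a + b) * pdh a b g p.1 p.2.1 p.2.2) ^ 2)
      (volume.restrict {p : ℝ × ℝ × ℝ | 0 < p.2.2})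

/-- `θ ⟨r⟩^{|α|} ∂^α_h ∂_z g ∈ L²(ℝ² × (0,∞))` for every `α` -/
def L2condZ (t : ℝ) (g : ℝ → ℝ → ℝ → ℝ) : Prop :=
  ∀ a b : ℕ,
    Integrable
      (fun p : ℝ × ℝ × ℝ =>
        (thw t 1 p.2.2 * angR p.1 p.2.1 ^ (a + b) * pdh a b (pdz g) p.1 p.2.1 p.2.2) ^ 2)
      (volume.restrict {p : ℝ × ℝ × ℝ | 0 < p.2.2})

/-- `X_n(g, τ)` -/
def Xel (t τ : ℝ) (g : ℝ → ℝ → ℝ → ℝ) (n : ℕ) : ℝ :=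
  (∑ a ∈ Finset.range (n + 1), L2w t 1 n (pdh a (n - a) g)) * τ ^ n * Mfac n

/-- `D_n(g, τ) = X_n(∂_z g, τ)` -/
def Del (t τ : ℝ) (g : ℝ → ℝ → ℝ → ℝ) (n : ℕ) : ℝ :=
  (∑ a ∈ Finset.range (n + 1), L2w t 1 n (pdh a (n - a) (pdz g))) * τ ^ n * Mfac n

/-- `Y_n(g, τ)` (with `Y₀ = 0`) -/
def Yel (t τ : ℝ) (g : ℝ → ℝ → ℝ → ℝ) (n : ℕ) : ℝ :=
  (∑ a ∈ Finset.range (n + 1), L2w t 1 n (pdh a (n - a) g)) * τ ^ (n - 1) * (n : ℝ) * Mfac n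

/-- `‖g‖_{X_τ}` -/
def Xnrm (t τ : ℝ) (g : ℝ → ℝ → ℝ → ℝ) : ℝ := ∑' n : ℕ, Xel t τ g n
/-- `‖g‖_{D_τ}` -/
def Dnrm (t τ : ℝ) (g : ℝ → ℝ → ℝ → ℝ) : ℝ := ∑' n : ℕ, Del t τ g n
/-- `‖g‖_{Y_τ}` -/
def Ynrm (t τ : ℝ) (g : ℝ → ℝ → ℝ → ℝ) : ℝ := ∑' n : ℕ, Yel t τ g n

/-- triple integral over `ℝ² × (0,∞)` -/
def trip (F : ℝ → ℝ → ℝ → ℝ) : ℝ := ∫ x : ℝ, ∫ y : ℝ, ∫ z in Ioi (0 : ℝ), F x y z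

/-- `I^α_1` -/
def I1 (t : ℝ) (g : ℝ → ℝ → ℝ → ℝ) (a b : ℕ) : ℝ :=
  -trip fun x y z =>
    thw t 2 z * angR x y ^ (2 * (a + b)) *
      pdh a b (fun x' y' z' => ur t g x' y' z' * rdr g x' y' z') x y z * pdh a b g x y z

/-- `I^α_2` -/
def I2 (t : ℝ) (g : ℝ → ℝ → ℝ → ℝ) (a b : ℕ) : ℝ :=
  -trip fun x y z =>
    thw t 2 z * angR x y ^ (2 * (a + b)) *
      pdh a b (fun x' y' z' => uzv t g x' y' z' * pdz g x' y' z') x y z * pdh a b g x y z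

/-- `I^α_3` -/
def I3 (t : ℝ) (g : ℝ → ℝ → ℝ → ℝ) (a b : ℕ) : ℝ :=
  -trip fun x y z =>
    thw t 2 z * angR x y ^ (2 * (a + b)) *
      pdh a b (fun x' y' z' => ur t g x' y' z' ^ 2) x y z * pdh a b g x y z

/-- `I^α_4` -/
def I4 (t : ℝ) (g : ℝ → ℝ → ℝ → ℝ) (a b : ℕ) : ℝ :=
  (1 / (2 * angT t)) * trip fun x y z =>
    thw t 2 z * angR x y ^ (2 * (a + b)) *
      pdh a b
        (fun x' y' z' =>
          uzv t g x' y' z' * pdz (fun x'' y'' w => w * phiF t g x'' y'' w) x' y' z') x y z *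
      pdh a b g x y z

/-- `I^α_5` -/
def I5 (t : ℝ) (g : ℝ → ℝ → ℝ → ℝ) (a b : ℕ) : ℝ :=
  -(1 / angT t) * trip fun x y z =>
    z * thw t 2 z * angR x y ^ (2 * (a + b)) *
      pdh a b (fun x' y' z' => ur t g x' y' z' * phiF t g x' y' z') x y z * pdh a b g x y z

/-- `I^α_6` -/
def I6 (t : ℝ) (g : ℝ → ℝ → ℝ → ℝ) (a b : ℕ) : ℝ :=
  -(1 / (2 * angT t)) * trip fun x y z =>
    z * thw t 2 z * angR x y ^ (2 * (a + b)) *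
      (∫ s in Ioi z, pdh a b (fun x' y' z' => ur t g x' y' z' ^ 2) x y s) * pdh a b g x y z

/-- `I^α_7` -/
def I7 (t : ℝ) (g : ℝ → ℝ → ℝ → ℝ) (a b : ℕ) : ℝ :=
  (1 / angT t) * trip fun x y z =>
    z * thw t 2 z * angR x y ^ (2 * (a + b)) *
      (∫ s in Ioi z, pdh a b (fun x' y' z' => pdz (ur t g) x' y' z' * uzv t g x' y' z') x y s) *
      pdh a b g x y z

/-- `∑_{|α| = n} |I^α| τⁿ Mₙ / ‖θ ⟨r⟩ⁿ ∂^α_h g‖_{L²}` (with the convention `x / 0 = 0`) -/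
def Qterm (t τ : ℝ) (g : ℝ → ℝ → ℝ → ℝ) (I : ℕ → ℕ → ℝ) (n : ℕ) : ℝ :=
  ∑ a ∈ Finset.range (n + 1), |I a (n - a)| * τ ^ n * Mfac n / L2w t 1 n (pdh a (n - a) g)

/-- `∂_t` -/
def pdt (G : ℝ → ℝ → ℝ → ℝ → ℝ) (t x y z : ℝ) : ℝ := deriv (fun t' => G t' x y z) t

/-- the good-unknown axially symmetric Prandtl equation at the point `(t, x, y, z)` -/
def GoodEq (G : ℝ → ℝ → ℝ → ℝ → ℝ) (t x y z : ℝ) : Prop :=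
  pdt G t x y z
      + ur t (G t) x y z * rdr (G t) x y z
      + uzv t (G t) x y z * pdz (G t) x y z
      - pdz (pdz (G t)) x y z
      + G t x y z / angT t
      + ur t (G t) x y z ^ 2
      - 1 / (2 * angT t) * (uzv t (G t) x y z * pdz (fun x' y' w => w * phiF t (G t) x' y' w) x y z)
      + z / angT t * (ur t (G t) x y z * phiF t (G t) x y z)
      + z / (2 * angT t) * (∫ s in Ioi z, ur t (G t) x y s ^ 2)
      - z / angT t * (∫ s in Ioi z, pdz (ur t (G t)) x y s * uzv t (G t) x y s) = 0

/-- Joint smoothness of a function of three real variables. -/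
def JointSmooth (g : ℝ → ℝ → ℝ → ℝ) : Prop :=
  ContDiff ℝ (⊤ : ℕ∞) (fun p : ℝ × ℝ × ℝ => g p.1 p.2.1 p.2.2)

theorem JointSmooth.hasDerivAt_x {g : ℝ → ℝ → ℝ → ℝ} (hg : JointSmooth g) (x y z : ℝ) :
    HasDerivAt (fun x' => g x' y z)
      (fderiv ℝ (fun p : ℝ × ℝ × ℝ => g p.1 p.2.1 p.2.2) (x, y, z) (1, 0, 0)) x :=
  ((hg.differentiable (by simp)) (x, y, z)).hasFDerivAt.comp_hasDerivAt
    (f := fun x' : ℝ => (x', y, z)) x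
    ((hasDerivAt_id x).prodMk ((hasDerivAt_const x y).prodMk (hasDerivAt_const x z)))

theorem JointSmooth.hasDerivAt_y {g : ℝ → ℝ → ℝ → ℝ} (hg : JointSmooth g) (x y z : ℝ) :
    HasDerivAt (fun y' => g x y' z)
      (fderiv ℝ (fun p : ℝ × ℝ × ℝ => g p.1 p.2.1 p.2.2) (x, y, z) (0, 1, 0)) y :=
  ((hg.differentiable (by simp)) (x, y, z)).hasFDerivAt.comp_hasDerivAt
    (f := fun y' : ℝ => (x, y', z)) y
    ((hasDerivAt_const y x).prodMk ((hasDerivAt_id y).prodMk (hasDerivAt_const y z)))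

theorem JointSmooth.pdx_eq {g : ℝ → ℝ → ℝ → ℝ} (hg : JointSmooth g) (x y z : ℝ) :
    pdx g x y z = fderiv ℝ (fun p : ℝ × ℝ × ℝ => g p.1 p.2.1 p.2.2) (x, y, z) (1, 0, 0) :=
  (hg.hasDerivAt_x x y z).deriv

theorem JointSmooth.pdy_eq {g : ℝ → ℝ → ℝ → ℝ} (hg : JointSmooth g) (x y z : ℝ) :
    pdy g x y z = fderiv ℝ (fun p : ℝ × ℝ × ℝ => g p.1 p.2.1 p.2.2) (x, y, z) (0, 1, 0) :=
  (hg.hasDerivAt_y x y z).deriv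

theorem JointSmooth.hasDerivAt_pdx {g : ℝ → ℝ → ℝ → ℝ} (hg : JointSmooth g) (x y z : ℝ) :
    HasDerivAt (fun x' => g x' y z) (pdx g x y z) x :=
  hg.pdx_eq x y z ▸ hg.hasDerivAt_x x y z

theorem JointSmooth.hasDerivAt_pdy {g : ℝ → ℝ → ℝ → ℝ} (hg : JointSmooth g) (x y z : ℝ) :
    HasDerivAt (fun y' => g x y' z) (pdy g x y z) y :=
  hg.pdy_eq x y z ▸ hg.hasDerivAt_y x y z

theorem JointSmooth.pdx {g : ℝ → ℝ → ℝ → ℝ} (hg : JointSmooth g) : JointSmooth (pdx g) := by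
  have h := (hg.fderiv_right (m := (⊤ : ℕ∞)) (by simp)).clm_apply
    (contDiff_const (c := ((1, 0, 0) : ℝ × ℝ × ℝ)))
  rwa [← funext fun p : ℝ × ℝ × ℝ => hg.pdx_eq p.1 p.2.1 p.2.2] at h

theorem JointSmooth.pdy {g : ℝ → ℝ → ℝ → ℝ} (hg : JointSmooth g) : JointSmooth (pdy g) := by
  have h := (hg.fderiv_right (m := (⊤ : ℕ∞)) (by simp)).clm_apply
    (contDiff_const (c := ((0, 1, 0) : ℝ × ℝ × ℝ)))
  rwa [← funext fun p : ℝ × ℝ × ℝ => hg.pdy_eq p.1 p.2.1 p.2.2] at h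

theorem JointSmooth.pdx_pdy {g : ℝ → ℝ → ℝ → ℝ} (hg : JointSmooth g) :
    _root_.pdy (_root_.pdx g) = _root_.pdx (_root_.pdy g) := by
  funext x y z
  have hd : DifferentiableAt ℝ (fderiv ℝ (fun p : ℝ × ℝ × ℝ => g p.1 p.2.1 p.2.2)) (x, y, z) :=
    (hg.fderiv_right (m := (⊤ : ℕ∞)) (by simp)).differentiable (by simp) _
  have key : ∀ v w : ℝ × ℝ × ℝ,
      fderiv ℝ (fun p => fderiv ℝ (fun p : ℝ × ℝ × ℝ => g p.1 p.2.1 p.2.2) p v) (x, y, z) w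
        = fderiv ℝ (fderiv ℝ (fun p : ℝ × ℝ × ℝ => g p.1 p.2.1 p.2.2)) (x, y, z) w v := by
    intro v w
    rw [fderiv_clm_apply hd (differentiableAt_const v)]
    simp
  rw [hg.pdx.pdy_eq, hg.pdy.pdx_eq]
  simp_rw [hg.pdx_eq, hg.pdy_eq]
  rw [key, key]
  exact (hg.contDiffAt.isSymmSndFDerivAt
    (by simpa using WithTop.coe_le_coe.2 (le_top : (2 : ℕ∞) ≤ ⊤))).eq _ _

theorem JointSmooth.iterate_pdx {g : ℝ → ℝ → ℝ → ℝ} (hg : JointSmooth g) (a : ℕ) :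
    JointSmooth (_root_.pdx^[a] g) := by
  induction a with
  | zero => exact hg
  | succ a ih => rw [Function.iterate_succ_apply']; exact ih.pdx

theorem JointSmooth.iterate_pdy {g : ℝ → ℝ → ℝ → ℝ} (hg : JointSmooth g) (b : ℕ) :
    JointSmooth (_root_.pdy^[b] g) := by
  induction b with
  | zero => exact hg
  | succ b ih => rw [Function.iterate_succ_apply']; exact ih.pdy

theorem JointSmooth.pdh {g : ℝ → ℝ → ℝ → ℝ} (hg : JointSmooth g) (a b : ℕ) :
    JointSmooth (pdh a b g) :=
  (hg.iterate_pdy b).iterate_pdx a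

theorem pdx_pdh (a b : ℕ) (g : ℝ → ℝ → ℝ → ℝ) : pdx (pdh a b g) = pdh (a + 1) b g :=
  (Function.iterate_succ_apply' pdx a _).symm

theorem JointSmooth.pdy_iterate_pdx {g : ℝ → ℝ → ℝ → ℝ} (hg : JointSmooth g) (a : ℕ) :
    _root_.pdy (_root_.pdx^[a] g) = _root_.pdx^[a] (_root_.pdy g) := by
  induction a with
  | zero => rfl
  | succ a ih =>
    rw [Function.iterate_succ_apply', Function.iterate_succ_apply',
      (hg.iterate_pdx a).pdx_pdy, ih]

theorem JointSmooth.pdy_pdh {g : ℝ → ℝ → ℝ → ℝ} (hg : JointSmooth g) (a b : ℕ) :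
    _root_.pdy (_root_.pdh a b g) = _root_.pdh a (b + 1) g := by
  unfold _root_.pdh
  rw [(hg.iterate_pdy b).pdy_iterate_pdx, Function.iterate_succ_apply']

theorem JointSmooth.continuous {g : ℝ → ℝ → ℝ → ℝ} (hg : JointSmooth g) :
    Continuous (fun p : ℝ × ℝ × ℝ => g p.1 p.2.1 p.2.2) :=
  ContDiff.continuous hg

/-- Differentiation under a weighted integral over a compact interval. -/
theorem hasDerivAt_intervalIntegral_mul {h h' : ℝ → ℝ → ℝ} {e : ℝ → ℝ}
    (hc : Continuous (fun p : ℝ × ℝ => h p.1 p.2))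
    (hc' : Continuous (fun p : ℝ × ℝ => h' p.1 p.2)) (he : Continuous e)
    (hd : ∀ x s, HasDerivAt (fun x' => h x' s) (h' x s) x) (x a b : ℝ) :
    HasDerivAt (fun x' => ∫ s in a..b, h x' s * e s) (∫ s in a..b, h' x s * e s) x := by
  obtain ⟨M, hM⟩ := ((isCompact_closedBall x 1).prod (isCompact_uIcc (a := a) (b := b))
    ).exists_bound_of_continuousOn (f := fun p : ℝ × ℝ => h' p.1 p.2 * e p.2)
      (hc'.mul (he.comp continuous_snd)).continuousOn
  have hF : ∀ x', Continuous (fun s => h x' s * e s) := fun x' =>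
    (hc.comp (by fun_prop : Continuous fun s : ℝ => (x', s))).mul he
  have hF' : Continuous (fun s => h' x s * e s) :=
    (hc'.comp (by fun_prop : Continuous fun s : ℝ => (x, s))).mul he
  refine (intervalIntegral.hasDerivAt_integral_of_dominated_loc_of_deriv_le
    (F := fun x' s => h x' s * e s) (F' := fun x' s => h' x' s * e s)
    (bound := fun _ => M) (Metric.closedBall_mem_nhds x one_pos)
    (Eventually.of_forall fun x' => (hF x').aestronglyMeasurable)
    ((hF x).intervalIntegrable a b) hF'.aestronglyMeasurable ?_
    intervalIntegrable_const ?_).2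
  · exact Eventually.of_forall fun s hs x' hx' => hM (x', s) ⟨hx', uIoc_subset_uIcc hs⟩
  · exact Eventually.of_forall fun s _ x' _ => (hd x' s).mul_const _

theorem JointSmooth.hasDerivAt_phiF_x {g : ℝ → ℝ → ℝ → ℝ} (hg : JointSmooth g) (t x y z : ℝ) :
    HasDerivAt (fun x' => phiF t g x' y z) (phiF t (_root_.pdx g) x y z) x :=
  (hasDerivAt_intervalIntegral_mul (h := fun x s => g x y s) (h' := fun x s => _root_.pdx g x y s)
    (hg.continuous.comp (by fun_prop : Continuous fun p : ℝ × ℝ => (p.1, y, p.2)))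
    (hg.pdx.continuous.comp (by fun_prop : Continuous fun p : ℝ × ℝ => (p.1, y, p.2)))
    (by fun_prop) (fun x s => hg.hasDerivAt_pdx x y s) x 0 z).const_mul _

theorem JointSmooth.hasDerivAt_phiF_y {g : ℝ → ℝ → ℝ → ℝ} (hg : JointSmooth g) (t x y z : ℝ) :
    HasDerivAt (fun y' => phiF t g x y' z) (phiF t (_root_.pdy g) x y z) y :=
  (hasDerivAt_intervalIntegral_mul (h := fun y s => g x y s) (h' := fun y s => _root_.pdy g x y s)
    (hg.continuous.comp (by fun_prop : Continuous fun p : ℝ × ℝ => (x, p.1, p.2)))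
    (hg.pdy.continuous.comp (by fun_prop : Continuous fun p : ℝ × ℝ => (x, p.1, p.2)))
    (by fun_prop) (fun y s => hg.hasDerivAt_pdy x y s) y 0 z).const_mul _

theorem JointSmooth.ur_eq {g : ℝ → ℝ → ℝ → ℝ} (hg : JointSmooth g) (t x y z : ℝ) :
    ur t g x y z = g x y z - z / (2 * angT t) * phiF t g x y z := by
  have hc : Continuous (fun s => g x y s * Real.exp (s ^ 2 / (4 * angT t))) :=
    (hg.continuous.comp (by fun_prop : Continuous fun s : ℝ => (x, y, s))).mul (by fun_prop)
  have h1 : HasDerivAt (fun z' : ℝ => Real.exp (-(z' ^ 2) / (4 * angT t)))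
      (Real.exp (-(z ^ 2) / (4 * angT t)) * (-(2 * z) / (4 * angT t))) z := by
    have := (((hasDerivAt_pow 2 z).neg).div_const (4 * angT t)).exp
    simpa using this
  have h2 := intervalIntegral.integral_hasDerivAt_right (hc.intervalIntegrable 0 z)
    (hc.stronglyMeasurableAtFilter _ _) hc.continuousAt
  have h3 : ur t g x y z = _ := (h1.mul h2).deriv
  have h4 : Real.exp (-(z ^ 2) / (4 * angT t)) * Real.exp (z ^ 2 / (4 * angT t)) = 1 := by
    rw [← Real.exp_add, neg_div, neg_add_cancel, Real.exp_zero]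
  have h5 : -(2 * z) / (4 * angT t) = -(z / (2 * angT t)) := by
    rw [neg_div, show 4 * angT t = 2 * (2 * angT t) by ring, mul_div_mul_left _ _ two_ne_zero]
  rw [h3, h5]
  unfold phiF
  linear_combination g x y z * h4

theorem JointSmooth.pdx_ur {g : ℝ → ℝ → ℝ → ℝ} (hg : JointSmooth g) (t : ℝ) :
    _root_.pdx (ur t g) = ur t (_root_.pdx g) := by
  funext x y z
  rw [hg.pdx.ur_eq]
  have h := (hg.hasDerivAt_pdx x y z).sub ((hg.hasDerivAt_phiF_x t x y z).const_mul
    (z / (2 * angT t)))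
  rw [← h.deriv]
  exact congrArg (fun f => deriv f x) (funext fun x' => hg.ur_eq t x' y z)

theorem JointSmooth.pdy_ur {g : ℝ → ℝ → ℝ → ℝ} (hg : JointSmooth g) (t : ℝ) :
    _root_.pdy (ur t g) = ur t (_root_.pdy g) := by
  funext x y z
  rw [hg.pdy.ur_eq]
  have h := (hg.hasDerivAt_pdy x y z).sub ((hg.hasDerivAt_phiF_y t x y z).const_mul
    (z / (2 * angT t)))
  rw [← h.deriv]
  exact congrArg (fun f => deriv f y) (funext fun y' => hg.ur_eq t x y' z)

theorem JointSmooth.pdh_ur {g : ℝ → ℝ → ℝ → ℝ} (hg : JointSmooth g) (t : ℝ) (a b : ℕ) :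
    _root_.pdh a b (ur t g) = ur t (_root_.pdh a b g) := by
  have hy : _root_.pdy^[b] (ur t g) = ur t (_root_.pdy^[b] g) := by
    induction b with
    | zero => rfl
    | succ b ih =>
      rw [Function.iterate_succ_apply', ih, (hg.iterate_pdy b).pdy_ur,
        Function.iterate_succ_apply']
  unfold _root_.pdh
  rw [hy]
  induction a with
  | zero => rfl
  | succ a ih =>
    rw [Function.iterate_succ_apply', ih, ((hg.iterate_pdy b).iterate_pdx a).pdx_ur,
      Function.iterate_succ_apply']

/-- A local one-dimensional Sobolev estimate with a slowly varying weight. -/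
theorem sq_mul_le_integral_of_weight {w w' h h' : ℝ → ℝ} {c : ℝ}
    (hw : ∀ x, HasDerivAt w (w' x) x) (hh : ∀ x, HasDerivAt h (h' x) x)
    (hwc' : Continuous w') (hhc' : Continuous h') (hw0 : ∀ x, 0 ≤ w x) (hc : 0 ≤ c)
    (hwb : ∀ x, |w' x| ≤ c * w x) (x₀ : ℝ) :
    (w x₀ * h x₀) ^ 2 ≤
      2 * (c + 1) * ∫ x in x₀..x₀ + 1, ((w x * h x) ^ 2 + (w x * h' x) ^ 2) := by
  have hwc : Continuous w := continuous_iff_continuousAt.2 fun x => (hw x).continuousAt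
  have hhc : Continuous h := continuous_iff_continuousAt.2 fun x => (hh x).continuousAt
  have hder : ∀ x, HasDerivAt (fun x => (w x * h x) ^ 2 * (x - (x₀ + 1)))
      (2 * (w x * h x) * (w' x * h x + w x * h' x) * (x - (x₀ + 1)) + (w x * h x) ^ 2) x := by
    intro x
    have := (((hw x).mul (hh x)).pow 2).mul ((hasDerivAt_id x).sub_const (x₀ + 1))
    refine this.congr_deriv ?_
    simp
  have hcont : Continuous (fun x => 2 * (w x * h x) * (w' x * h x + w x * h' x) * (x - (x₀ + 1))
      + (w x * h x) ^ 2) := by fun_prop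
  have hftc := intervalIntegral.integral_eq_sub_of_hasDerivAt (fun x _ => hder x)
    (hcont.intervalIntegrable x₀ (x₀ + 1))
  have hval : (w x₀ * h x₀) ^ 2 = ∫ x in x₀..x₀ + 1,
      (2 * (w x * h x) * (w' x * h x + w x * h' x) * (x - (x₀ + 1)) + (w x * h x) ^ 2) := by
    rw [hftc]; ring
  rw [hval, ← intervalIntegral.integral_const_mul]
  refine intervalIntegral.integral_mono_on (by linarith) (hcont.intervalIntegrable _ _)
    (Continuous.intervalIntegrable (by fun_prop) _ _) fun x hx => ?_
  have hs : |x - (x₀ + 1)| ≤ 1 := by rw [abs_le]; constructor <;> linarith [hx.1, hx.2]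
  have hb : |w' x * h x| ≤ c * |w x * h x| := by
    rw [abs_mul, abs_mul, abs_of_nonneg (hw0 x), ← mul_assoc]
    gcongr
    exact hwb x
  generalize w' x * h x = B at *
  generalize w x * h x = A at *
  generalize w x * h' x = D at *
  have h1 : 2 * A * (B + D) * (x - (x₀ + 1)) ≤ 2 * |A| * (c * |A| + |D|) := by
    calc 2 * A * (B + D) * (x - (x₀ + 1)) ≤ |2 * A * (B + D) * (x - (x₀ + 1))| := le_abs_self _
      _ = 2 * |A| * |B + D| * |x - (x₀ + 1)| := by simp [abs_mul]
      _ ≤ 2 * |A| * (c * |A| + |D|) * 1 := by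
        gcongr
        exact (abs_add_le B D).trans (by gcongr)
      _ = _ := mul_one _
  nlinarith [sq_nonneg (|A| - |D|), sq_abs A, sq_abs D, mul_nonneg hc (sq_nonneg D), sq_nonneg A,
    sq_nonneg D]

theorem one_le_angR (x y : ℝ) : 1 ≤ angR x y :=
  Real.one_le_sqrt.2 (by nlinarith [sq_nonneg x, sq_nonneg y])

theorem angR_comm (x y : ℝ) : angR x y = angR y x := by
  unfold angR; rw [add_comm (x ^ 2)]

theorem continuous_angR : Continuous (fun p : ℝ × ℝ => angR p.1 p.2) := by
  unfold angR; fun_prop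

theorem hasDerivAt_angR_pow (n : ℕ) (x y : ℝ) :
    HasDerivAt (fun x' => angR x' y ^ n) (n * angR x y ^ (n - 1) * (x / angR x y)) x := by
  have h0 : x ^ 2 + y ^ 2 + 1 ≠ 0 := by positivity
  have h1 : HasDerivAt (fun x' => angR x' y) (x / angR x y) x := by
    refine ((((hasDerivAt_pow 2 x).add_const (y ^ 2)).add_const 1).sqrt h0).congr_deriv ?_
    unfold angR
    simp [mul_div_mul_left]
  exact h1.pow n

theorem abs_deriv_angR_pow_le (n : ℕ) (x y : ℝ) :
    |n * angR x y ^ (n - 1) * (x / angR x y)| ≤ n * angR x y ^ n := by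
  have h1 := one_le_angR x y
  have h2 : |x / angR x y| ≤ 1 := by
    rw [abs_div, abs_of_pos (by linarith : 0 < angR x y), div_le_one (by linarith)]
    exact Real.abs_le_sqrt (by nlinarith [sq_nonneg y])
  have h3 : angR x y ^ (n - 1) ≤ angR x y ^ n := pow_le_pow_right₀ h1 (Nat.sub_le n 1)
  rw [abs_mul, abs_of_nonneg (by positivity)]
  calc _ ≤ n * angR x y ^ n * 1 := by gcongr
    _ = _ := mul_one _

/-- The one-dimensional estimate with weight `⟨r⟩ⁿ`, in the first horizontal variable. -/
theorem sq_angR_pow_mul_le {h h' : ℝ → ℝ} (hh : ∀ x, HasDerivAt h (h' x) x)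
    (hhc' : Continuous h') (n : ℕ) (x₀ y : ℝ) :
    (angR x₀ y ^ n * h x₀) ^ 2 ≤ 2 * ((n : ℝ) + 1) *
      ∫ x in x₀..x₀ + 1, ((angR x y ^ n * h x) ^ 2 + (angR x y ^ n * h' x) ^ 2) := by
  have hc : Continuous (fun x => angR x y) :=
    continuous_angR.comp (by fun_prop : Continuous fun x : ℝ => (x, y))
  have h0 : ∀ x, angR x y ≠ 0 := fun x => (zero_lt_one.trans_le (one_le_angR x y)).ne'
  exact sq_mul_le_integral_of_weight (w := fun x => angR x y ^ n)
    (fun x => hasDerivAt_angR_pow n x y) hh (by fun_prop (disch := exact h0 _)) hhc'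
    (fun x => pow_nonneg (zero_le_one.trans (one_le_angR x y)) n) n.cast_nonneg
    (fun x => abs_deriv_angR_pow_le n x y) x₀

/-- A two-dimensional Sobolev estimate with polynomial weights. -/
theorem sq_angR_pow_mul_le_integral {k kx ky kxy : ℝ → ℝ → ℝ}
    (hk : Continuous (fun p : ℝ × ℝ => k p.1 p.2))
    (hkx : Continuous (fun p : ℝ × ℝ => kx p.1 p.2))
    (hky : Continuous (fun p : ℝ × ℝ => ky p.1 p.2))
    (hkxy : Continuous (fun p : ℝ × ℝ => kxy p.1 p.2))
    (hdx : ∀ x y, HasDerivAt (fun x' => k x' y) (kx x y) x)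
    (hdy : ∀ x y, HasDerivAt (fun y' => k x y') (ky x y) y)
    (hdxy : ∀ x y, HasDerivAt (fun y' => kx x y') (kxy x y) y) (n : ℕ)
    (hint : Integrable (fun p : ℝ × ℝ =>
      (angR p.1 p.2 ^ n * k p.1 p.2) ^ 2 + (angR p.1 p.2 ^ (n + 1) * kx p.1 p.2) ^ 2 +
      (angR p.1 p.2 ^ (n + 1) * ky p.1 p.2) ^ 2 + (angR p.1 p.2 ^ (n + 2) * kxy p.1 p.2) ^ 2))
    (x₀ y₀ : ℝ) :
    (angR x₀ y₀ ^ n * k x₀ y₀) ^ 2 ≤ (2 * ((n : ℝ) + 1)) ^ 2 * ∫ p : ℝ × ℝ,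
      ((angR p.1 p.2 ^ n * k p.1 p.2) ^ 2 + (angR p.1 p.2 ^ (n + 1) * kx p.1 p.2) ^ 2 +
      (angR p.1 p.2 ^ (n + 1) * ky p.1 p.2) ^ 2 + (angR p.1 p.2 ^ (n + 2) * kxy p.1 p.2) ^ 2) := by
  have hr := continuous_angR
  have hin : ∀ x, (angR x y₀ ^ n * k x y₀) ^ 2 + (angR x y₀ ^ n * kx x y₀) ^ 2 ≤
      2 * ((n : ℝ) + 1) * ∫ y in y₀..y₀ + 1,
        ((angR x y ^ n * k x y) ^ 2 + (angR x y ^ n * ky x y) ^ 2 +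
          ((angR x y ^ n * kx x y) ^ 2 + (angR x y ^ n * kxy x y) ^ 2)) := by
    intro x
    have hl : Continuous fun y : ℝ => (x, y) := by fun_prop
    have c0 := hr.comp hl
    have c1 := hk.comp hl
    have c2 := hkx.comp hl
    have c3 := hky.comp hl
    have c4 := hkxy.comp hl
    simp only [Function.comp_def] at c0 c1 c2 c3 c4
    have e1 := sq_angR_pow_mul_le (fun y => hdy x y) c3 n y₀ x
    have e2 := sq_angR_pow_mul_le (fun y => hdxy x y) c4 n y₀ x
    simp only [angR_comm _ x] at e1 e2
    rw [intervalIntegral.integral_add (Continuous.intervalIntegrable (by fun_prop) _ _)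
      (Continuous.intervalIntegrable (by fun_prop) _ _), mul_add]
    exact add_le_add e1 e2
  have hQ : Continuous (fun p : ℝ × ℝ =>
      (angR p.1 p.2 ^ n * k p.1 p.2) ^ 2 + (angR p.1 p.2 ^ n * ky p.1 p.2) ^ 2 +
          ((angR p.1 p.2 ^ n * kx p.1 p.2) ^ 2 + (angR p.1 p.2 ^ n * kxy p.1 p.2) ^ 2)) := by
    fun_prop
  have hl : Continuous fun x : ℝ => (x, y₀) := by fun_prop
  have c0 := hr.comp hl
  have c1 := hk.comp hl
  have c2 := hkx.comp hl
  simp only [Function.comp_def] at c0 c1 c2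
  have e := sq_angR_pow_mul_le (fun x => hdx x y₀) c2 n x₀ y₀
  have hmono := intervalIntegral.integral_mono_on (μ := volume) (by linarith : x₀ ≤ x₀ + 1)
    (Continuous.intervalIntegrable (by fun_prop) _ _)
    (Continuous.intervalIntegrable
      (continuous_const.mul (intervalIntegral.continuous_parametric_intervalIntegral_of_continuous'
        (f := fun x y => (angR x y ^ n * k x y) ^ 2 + (angR x y ^ n * ky x y) ^ 2 +
          ((angR x y ^ n * kx x y) ^ 2 + (angR x y ^ n * kxy x y) ^ 2)) hQ y₀ (y₀ + 1))) _ _)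
    (fun x _ => hin x)
  simp only [Pi.mul_apply, intervalIntegral.integral_const_mul] at hmono
  have hQI : IntegrableOn (fun p : ℝ × ℝ =>
      (angR p.1 p.2 ^ n * k p.1 p.2) ^ 2 + (angR p.1 p.2 ^ n * ky p.1 p.2) ^ 2 +
          ((angR p.1 p.2 ^ n * kx p.1 p.2) ^ 2 + (angR p.1 p.2 ^ n * kxy p.1 p.2) ^ 2))
      (Ioc x₀ (x₀ + 1) ×ˢ Ioc y₀ (y₀ + 1)) :=
    (hQ.continuousOn.integrableOn_compact (isCompact_Icc.prod isCompact_Icc)).mono_set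
      (prod_mono Ioc_subset_Icc_self Ioc_subset_Icc_self)
  have hsq : (∫ x in x₀..x₀ + 1, ∫ y in y₀..y₀ + 1,
      ((angR x y ^ n * k x y) ^ 2 + (angR x y ^ n * ky x y) ^ 2 +
          ((angR x y ^ n * kx x y) ^ 2 + (angR x y ^ n * kxy x y) ^ 2))) =
      ∫ p in Ioc x₀ (x₀ + 1) ×ˢ Ioc y₀ (y₀ + 1),
        ((angR p.1 p.2 ^ n * k p.1 p.2) ^ 2 + (angR p.1 p.2 ^ n * ky p.1 p.2) ^ 2 +
          ((angR p.1 p.2 ^ n * kx p.1 p.2) ^ 2 + (angR p.1 p.2 ^ n * kxy p.1 p.2) ^ 2)) := by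
    rw [Measure.volume_eq_prod, setIntegral_prod _ hQI,
      intervalIntegral.integral_of_le (by linarith)]
    simp_rw [intervalIntegral.integral_of_le (by linarith : y₀ ≤ y₀ + 1)]
  have hle : ∀ p : ℝ × ℝ,
      (angR p.1 p.2 ^ n * k p.1 p.2) ^ 2 + (angR p.1 p.2 ^ n * ky p.1 p.2) ^ 2 +
          ((angR p.1 p.2 ^ n * kx p.1 p.2) ^ 2 + (angR p.1 p.2 ^ n * kxy p.1 p.2) ^ 2) ≤
      (angR p.1 p.2 ^ n * k p.1 p.2) ^ 2 + (angR p.1 p.2 ^ (n + 1) * kx p.1 p.2) ^ 2 +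
      (angR p.1 p.2 ^ (n + 1) * ky p.1 p.2) ^ 2 +
      (angR p.1 p.2 ^ (n + 2) * kxy p.1 p.2) ^ 2 := by
    intro p
    have hm : ∀ (m : ℕ) (c : ℝ), n ≤ m →
        (angR p.1 p.2 ^ n * c) ^ 2 ≤ (angR p.1 p.2 ^ m * c) ^ 2 := by
      intro m c hnm
      have h1 := one_le_angR p.1 p.2
      rw [mul_pow, mul_pow]
      gcongr
    linarith [hm (n + 1) (kx p.1 p.2) (by lia), hm (n + 1) (ky p.1 p.2) (by lia),
      hm (n + 2) (kxy p.1 p.2) (by lia)]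
  have hfin := (setIntegral_mono hQI hint.integrableOn hle).trans
    (setIntegral_le_integral hint (Eventually.of_forall fun p => by positivity))
  rw [← hsq] at hfin
  refine e.trans ((mul_le_mul_of_nonneg_left hmono (by positivity)).trans ?_)
  rw [sq (2 * ((n : ℝ) + 1)), mul_assoc (2 * ((n : ℝ) + 1))]
  gcongr

/-- Cauchy–Schwarz against the constant function on a compact interval. -/
theorem sq_intervalIntegral_le {f : ℝ → ℝ} (hf : Continuous f) {z : ℝ} (hz : 0 < z) :
    (∫ s in (0 : ℝ)..z, f s) ^ 2 ≤ z * ∫ s in (0 : ℝ)..z, f s ^ 2 := by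
  set J := ∫ s in (0 : ℝ)..z, f s with hJ
  have h0 : 0 ≤ ∫ s in (0 : ℝ)..z, (z * f s - J) ^ 2 :=
    intervalIntegral.integral_nonneg hz.le fun s _ => sq_nonneg _
  have h1 : (∫ s in (0 : ℝ)..z, (z * f s - J) ^ 2) =
      z ^ 2 * (∫ s in (0 : ℝ)..z, f s ^ 2) - 2 * z * J * J + z * J ^ 2 := by
    have h2 : ∀ s, (z * f s - J) ^ 2 = z ^ 2 * f s ^ 2 - 2 * z * J * f s + J ^ 2 :=
      fun s => by ring
    simp_rw [h2]
    rw [intervalIntegral.integral_add (Continuous.intervalIntegrable (by fun_prop) _ _)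
        (Continuous.intervalIntegrable (by fun_prop) _ _),
      intervalIntegral.integral_sub (Continuous.intervalIntegrable (by fun_prop) _ _)
        (Continuous.intervalIntegrable (by fun_prop) _ _),
      intervalIntegral.integral_const_mul, intervalIntegral.integral_const_mul, ← hJ]
    simp
  rw [h1] at h0
  have h3 : 0 ≤ z * (z * (∫ s in (0 : ℝ)..z, f s ^ 2) - J ^ 2) := by linarith
  linarith [nonneg_of_mul_nonneg_right h3 hz]

theorem integrableOn_pow_three_mul_exp_neg_mul_sq {b : ℝ} (hb : 0 < b) :
    IntegrableOn (fun z : ℝ => z ^ 3 * Real.exp (-b * z ^ 2)) (Ioi 0) := by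
  simpa using integrableOn_rpow_mul_exp_neg_mul_rpow (s := 3) (p := 2) (by norm_num)
    (by norm_num) hb

theorem integral_pow_three_mul_exp_neg_mul_sq {b : ℝ} (hb : 0 < b) :
    ∫ z in Ioi (0 : ℝ), z ^ 3 * Real.exp (-b * z ^ 2) = 1 / (2 * b ^ 2) := by
  have h := integral_rpow_mul_exp_neg_mul_rpow (p := 2) (q := 3) (b := b) (by norm_num)
    (by norm_num) hb
  norm_num at h
  simp only [neg_mul]
  rw [h]
  ring

theorem angT_pos {t : ℝ} (ht : 0 ≤ t) : 0 < angT t := by unfold angT; linarith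

theorem continuous_thw (t lam : ℝ) : Continuous (thw t lam) := by unfold thw; fun_prop

/-- Pointwise control of the nonlocal part of `u^r`. -/
theorem sq_mul_phiF_le {k : ℝ → ℝ → ℝ → ℝ} (hk : JointSmooth k) {t : ℝ} (ht : 0 ≤ t)
    (lam : ℝ) (n : ℕ) {q : ℝ → ℝ} (hq : IntegrableOn q (Ioi 0))
    (hb : ∀ᵐ z ∂(volume.restrict (Ioi (0 : ℝ))), ∀ x y,
      (thw t 1 z * angR x y ^ n * k x y z) ^ 2 ≤ q z) {z : ℝ} (hz : 0 < z) (x y : ℝ) :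
    (thw t lam z * angR x y ^ n * (z / (2 * angT t) * phiF t k x y z)) ^ 2 ≤
      (∫ s in Ioi (0 : ℝ), q s) / (4 * angT t ^ 2) *
        (z ^ 3 * Real.exp (-((1 - lam) / (4 * angT t)) * z ^ 2)) := by
  have hT := angT_pos ht
  have hcθ := continuous_thw t 1
  have hck : Continuous (fun s => k x y s) :=
    hk.continuous.comp (by fun_prop : Continuous fun s : ℝ => (x, y, s))
  have hcf : Continuous (fun s => thw t 1 s * angR x y ^ n * k x y s) := by fun_prop
  have hphi : angR x y ^ n * phiF t k x y z = Real.exp (-(z ^ 2) / (4 * angT t)) *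
      ∫ s in (0 : ℝ)..z, (thw t 1 s * angR x y ^ n * k x y s) * thw t 1 s := by
    unfold phiF
    rw [mul_left_comm, ← intervalIntegral.integral_const_mul]
    congr 1
    refine intervalIntegral.integral_congr fun s _ => ?_
    have : Real.exp (s ^ 2 / (4 * angT t)) = thw t 1 s * thw t 1 s := by
      unfold thw
      rw [← Real.exp_add]
      congr 1
      field_simp
      ring
    simp only [this]
    ring
  have hqnn : 0 ≤ᵐ[volume.restrict (Ioi (0 : ℝ))] q :=
    hb.mono fun s hs => (sq_nonneg _).trans (hs x y)
  have hI : (∫ s in (0 : ℝ)..z, ((thw t 1 s * angR x y ^ n * k x y s) * thw t 1 s) ^ 2) ≤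
      thw t 1 z ^ 2 * ∫ s in Ioi (0 : ℝ), q s := by
    have hsub : Ioc 0 z ⊆ Ioi (0 : ℝ) := Ioc_subset_Ioi_self
    calc _ ≤ ∫ s in (0 : ℝ)..z, thw t 1 z ^ 2 * (thw t 1 s * angR x y ^ n * k x y s) ^ 2 := by
          refine intervalIntegral.integral_mono_on hz.le
            (Continuous.intervalIntegrable (by fun_prop) _ _)
            (Continuous.intervalIntegrable (by fun_prop) _ _) fun s hs => ?_
          rw [mul_pow, mul_comm]
          have h1 : thw t 1 s ≤ thw t 1 z := by
            unfold thw
            have := hs.1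
            have := hs.2
            gcongr
          have h2 : 0 ≤ thw t 1 s := (Real.exp_pos _).le
          gcongr
      _ = thw t 1 z ^ 2 * ∫ s in Ioc 0 z, (thw t 1 s * angR x y ^ n * k x y s) ^ 2 := by
          rw [intervalIntegral.integral_const_mul, intervalIntegral.integral_of_le hz.le]
      _ ≤ thw t 1 z ^ 2 * ∫ s in Ioc 0 z, q s := by
          refine mul_le_mul_of_nonneg_left ?_ (sq_nonneg _)
          refine setIntegral_mono_ae_restrict ?_ (hq.mono_set hsub) ?_
          · exact ((hcf.pow 2).integrableOn_Icc (μ := volume)).mono_set Ioc_subset_Icc_self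
          · exact (ae_restrict_of_ae_restrict_of_subset hsub hb).mono fun s hs => hs x y
      _ ≤ _ := by
          refine mul_le_mul_of_nonneg_left ?_ (sq_nonneg _)
          exact setIntegral_mono_set hq hqnn hsub.eventuallyLE
  have hCS := (sq_intervalIntegral_le (f := fun s =>
    (thw t 1 s * angR x y ^ n * k x y s) * thw t 1 s) (by fun_prop) hz).trans
      (mul_le_mul_of_nonneg_left hI hz.le)
  have hexp : thw t lam z ^ 2 * Real.exp (-(z ^ 2) / (4 * angT t)) ^ 2 * thw t 1 z ^ 2 =
      Real.exp (-((1 - lam) / (4 * angT t)) * z ^ 2) := by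
    unfold thw
    rw [← Real.exp_nat_mul, ← Real.exp_nat_mul, ← Real.exp_nat_mul, ← Real.exp_add,
      ← Real.exp_add]
    congr 1
    push_cast
    field_simp
    ring
  set J := ∫ s in (0 : ℝ)..z, (thw t 1 s * angR x y ^ n * k x y s) * thw t 1 s
  set Q := ∫ s in Ioi (0 : ℝ), q s
  calc (thw t lam z * angR x y ^ n * (z / (2 * angT t) * phiF t k x y z)) ^ 2
      = (thw t lam z * (z / (2 * angT t)) * (angR x y ^ n * phiF t k x y z)) ^ 2 := by ring
    _ = thw t lam z ^ 2 * Real.exp (-(z ^ 2) / (4 * angT t)) ^ 2 *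
          (z / (2 * angT t)) ^ 2 * J ^ 2 := by rw [hphi]; ring
    _ ≤ thw t lam z ^ 2 * Real.exp (-(z ^ 2) / (4 * angT t)) ^ 2 *
          (z / (2 * angT t)) ^ 2 * (z * (thw t 1 z ^ 2 * Q)) := by gcongr
    _ = (z / (2 * angT t)) ^ 2 * z * Q * (thw t lam z ^ 2 *
          Real.exp (-(z ^ 2) / (4 * angT t)) ^ 2 * thw t 1 z ^ 2) := by ring
    _ = _ := by
      rw [hexp]
      field_simp
      ring

/-- The mixed norm of `u^r` is controlled by any integrable majorant of the weighted good
unknown that is uniform in the horizontal variables. -/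
theorem LIh2z_ur_le {k : ℝ → ℝ → ℝ → ℝ} (hk : JointSmooth k) {t : ℝ} (ht : 0 ≤ t)
    {lam : ℝ} (hlam : lam < 1) (n : ℕ) {q : ℝ → ℝ} (hq : IntegrableOn q (Ioi 0))
    (hb : ∀ᵐ z ∂(volume.restrict (Ioi (0 : ℝ))), ∀ x y,
      (thw t 1 z * angR x y ^ n * k x y z) ^ 2 ≤ q z) :
    LIh2z t lam n (ur t k) ≤
      Real.sqrt ((2 + 4 / (1 - lam) ^ 2) * ∫ z in Ioi (0 : ℝ), q z) := by
  have hT := angT_pos ht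
  have h1l : 0 < 1 - lam := by linarith
  have hβ : 0 < (1 - lam) / (4 * angT t) := by positivity
  have hG := (integrableOn_pow_three_mul_exp_neg_mul_sq hβ).const_mul
    (2 * ((∫ s in Ioi (0 : ℝ), q s) / (4 * angT t ^ 2)))
  refine Real.sqrt_le_sqrt ?_
  have hpt : ∀ᵐ z ∂(volume.restrict (Ioi (0 : ℝ))),
      (⨆ p : ℝ × ℝ, |thw t lam z * angR p.1 p.2 ^ n * ur t k p.1 p.2 z|) ^ 2 ≤
        2 * q z + 2 * ((∫ s in Ioi (0 : ℝ), q s) / (4 * angT t ^ 2)) *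
          (z ^ 3 * Real.exp (-((1 - lam) / (4 * angT t)) * z ^ 2)) := by
    filter_upwards [hb, ae_restrict_mem measurableSet_Ioi] with z hbz hz
    have hp : ∀ p : ℝ × ℝ, (thw t lam z * angR p.1 p.2 ^ n * ur t k p.1 p.2 z) ^ 2 ≤
        2 * q z + 2 * ((∫ s in Ioi (0 : ℝ), q s) / (4 * angT t ^ 2)) *
          (z ^ 3 * Real.exp (-((1 - lam) / (4 * angT t)) * z ^ 2)) := by
      intro p
      have hB := sq_mul_phiF_le hk ht lam n hq hb hz p.1 p.2
      have hA : (thw t lam z * angR p.1 p.2 ^ n * k p.1 p.2 z) ^ 2 ≤ q z := by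
        refine le_trans ?_ (hbz p.1 p.2)
        have h1 : thw t lam z ≤ thw t 1 z := by unfold thw; gcongr
        have h2 : 0 ≤ thw t lam z := (Real.exp_pos _).le
        rw [mul_assoc, mul_assoc, mul_pow, mul_pow (thw t 1 z)]
        gcongr
      rw [hk.ur_eq, mul_sub]
      generalize thw t lam z * angR p.1 p.2 ^ n * k p.1 p.2 z = A at *
      generalize thw t lam z * angR p.1 p.2 ^ n * (z / (2 * angT t) * phiF t k p.1 p.2 z) = B at *
      nlinarith [sq_nonneg (A + B)]
    have h0 := (sq_nonneg _).trans (hp 0)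
    calc _ ≤ Real.sqrt (2 * q z + 2 * ((∫ s in Ioi (0 : ℝ), q s) / (4 * angT t ^ 2)) *
          (z ^ 3 * Real.exp (-((1 - lam) / (4 * angT t)) * z ^ 2))) ^ 2 := by
          gcongr
          · exact Real.iSup_nonneg fun p => abs_nonneg _
          · exact ciSup_le fun p => Real.abs_le_sqrt (hp p)
      _ = _ := Real.sq_sqrt h0
  refine (integral_mono_of_nonneg (Eventually.of_forall fun z => sq_nonneg _)
    ((hq.const_mul 2).add hG) hpt).trans (le_of_eq ?_)
  simp only [Pi.add_apply]
  rw [integral_add (hq.const_mul 2) hG, integral_const_mul, integral_const_mul,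
    integral_pow_three_mul_exp_neg_mul_sq hβ]
  field_simp

theorem restrict_pos_eq_prod :
    (volume.restrict {p : ℝ × ℝ × ℝ | 0 < p.2.2}) =
      (volume : Measure ℝ).prod ((volume : Measure ℝ).prod (volume.restrict (Ioi (0 : ℝ)))) := by
  have h : {p : ℝ × ℝ × ℝ | 0 < p.2.2} = univ ×ˢ (univ ×ˢ Ioi (0 : ℝ)) := by
    ext p; simp
  rw [h, Measure.volume_eq_prod, ← Measure.prod_restrict, Measure.volume_eq_prod,
    ← Measure.prod_restrict, Measure.restrict_univ]

/-- Fubini on the upper half space, with the vertical variable outermost. -/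
theorem integrable_slices_halfSpace {F : ℝ × ℝ × ℝ → ℝ}
    (hF : Integrable F (volume.restrict {p : ℝ × ℝ × ℝ | 0 < p.2.2})) :
    (∀ᵐ z ∂(volume.restrict (Ioi (0 : ℝ))), Integrable (fun p : ℝ × ℝ => F (p.1, p.2, z))) ∧
    IntegrableOn (fun z => ∫ p : ℝ × ℝ, F (p.1, p.2, z)) (Ioi 0) ∧
    ∫ z in Ioi (0 : ℝ), ∫ p : ℝ × ℝ, F (p.1, p.2, z) =
      ∫ x : ℝ, ∫ y : ℝ, ∫ z in Ioi (0 : ℝ), F (x, y, z) := by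
  rw [restrict_pos_eq_prod] at hF
  have hmp := measurePreserving_prodAssoc (volume : Measure ℝ) (volume : Measure ℝ)
    (volume.restrict (Ioi (0 : ℝ)))
  have hF' : Integrable (F ∘ MeasurableEquiv.prodAssoc)
      (((volume : Measure ℝ).prod (volume : Measure ℝ)).prod (volume.restrict (Ioi (0 : ℝ)))) :=
    (hmp.integrable_comp_emb (MeasurableEquiv.measurableEmbedding _)).2 hF
  refine ⟨hF'.prod_left_ae, hF'.integral_prod_right, ?_⟩
  have h1 := integral_prod_symm _ hF'
  have h2 := hmp.integral_comp (MeasurableEquiv.measurableEmbedding _) F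
  refine h1.symm.trans (h2.trans ?_)
  rw [integral_prod _ hF]
  refine integral_congr_ae ?_
  filter_upwards [hF.prod_right_ae] with x hx
  exact integral_prod _ hx

theorem sqrt_add_le_sqrt_add_sqrt (u v : ℝ) :
    Real.sqrt (u + v) ≤ Real.sqrt u + Real.sqrt v := by
  have h : ∀ w : ℝ, w ≤ Real.sqrt w ^ 2 := fun w => by
    rcases le_total 0 w with hw | hw
    · rw [Real.sq_sqrt hw]
    · exact hw.trans (sq_nonneg _)
  refine Real.sqrt_le_iff.2 ⟨by positivity, ?_⟩
  nlinarith [h u, h v, mul_nonneg (Real.sqrt_nonneg u) (Real.sqrt_nonneg v)]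

theorem integral_add_add_add {β : Type*} [MeasurableSpace β] {μ : Measure β} {f g h k : β → ℝ}
    (hf : Integrable f μ) (hg : Integrable g μ) (hh : Integrable h μ) (hk : Integrable k μ) :
    ∫ a, (f a + g a + h a + k a) ∂μ =
      (∫ a, f a ∂μ) + (∫ a, g a ∂μ) + (∫ a, h a ∂μ) + ∫ a, k a ∂μ := by
  rw [integral_add (f := fun a => f a + g a + h a) ((hf.add hg).add hh) hk,
    integral_add (f := fun a => f a + g a) (hf.add hg) hh, integral_add hf hg]

/-- The contribution of a single multi-index. -/
theorem LIh2z_pdh_ur_le {g : ℝ → ℝ → ℝ → ℝ} (hg : JointSmooth g) {t : ℝ} (ht : 0 ≤ t)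
    (hL : L2cond t g) {lam : ℝ} (hlam : lam < 1) (a b : ℕ) :
    LIh2z t lam (a + b) (pdh a b (ur t g)) ≤
      Real.sqrt (2 + 4 / (1 - lam) ^ 2) * (2 * (((a + b : ℕ) : ℝ) + 1)) *
        (L2w t 1 (a + b) (pdh a b g) + L2w t 1 (a + 1 + b) (pdh (a + 1) b g) +
          L2w t 1 (a + (b + 1)) (pdh a (b + 1) g) +
          L2w t 1 (a + 1 + (b + 1)) (pdh (a + 1) (b + 1) g)) := by
  obtain ⟨i0, j0, e0⟩ := integrable_slices_halfSpace (hL a b)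
  obtain ⟨i1, j1, e1⟩ := integrable_slices_halfSpace (hL (a + 1) b)
  obtain ⟨i2, j2, e2⟩ := integrable_slices_halfSpace (hL a (b + 1))
  obtain ⟨i3, j3, e3⟩ := integrable_slices_halfSpace (hL (a + 1) (b + 1))
  dsimp only at i0 j0 e0 i1 j1 e1 i2 j2 e2 i3 j3 e3
  have hk := hg.pdh a b
  have hx : pdx (pdh a b g) = pdh (a + 1) b g := pdx_pdh a b g
  have hy : pdy (pdh a b g) = pdh a (b + 1) g := hg.pdy_pdh a b
  have hxy : pdy (pdh (a + 1) b g) = pdh (a + 1) (b + 1) g := hg.pdy_pdh (a + 1) b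
  have hq := (((j0.add j1).add j2).add j3).const_mul ((2 * (((a + b : ℕ) : ℝ) + 1)) ^ 2)
  have hbound := LIh2z_ur_le hk ht hlam (a + b) hq ?_
  · rw [hg.pdh_ur]
    refine hbound.trans ?_
    simp only [Pi.add_apply]
    rw [integral_const_mul, integral_add_add_add j0 j1 j2 j3, e0, e1, e2, e3, Real.sqrt_mul (by positivity), mul_assoc]
    gcongr
    rw [Real.sqrt_mul (sq_nonneg _), Real.sqrt_sq (by positivity)]
    gcongr
    unfold L2w
    refine (sqrt_add_le_sqrt_add_sqrt _ _).trans (add_le_add_left ?_ _)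
    refine (sqrt_add_le_sqrt_add_sqrt _ _).trans (add_le_add_left ?_ _)
    exact sqrt_add_le_sqrt_add_sqrt _ _
  · filter_upwards [i0, i1, i2, i3] with z h0 h1 h2 h3 x y
    have hl : Continuous fun p : ℝ × ℝ => (p.1, p.2, z) := by fun_prop
    have r1 : a + 1 + b = a + b + 1 := by ring
    have r2 : a + (b + 1) = a + b + 1 := by ring
    have r3 : a + 1 + (b + 1) = a + b + 2 := by ring
    rw [r1] at h1
    rw [r2] at h2
    rw [r3] at h3
    simp only [Pi.add_apply, r1, r2, r3]
    rw [← integral_add_add_add h0 h1 h2 h3]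
    have hint := ((h0.add h1).add h2).add h3
    have comm : ∀ u v w : ℝ, u * v * w = v * (u * w) := fun u v w => by ring
    simp only [comm (thw t 1 z), Pi.add_def] at hint ⊢
    refine sq_angR_pow_mul_le_integral
      (k := fun x y => thw t 1 z * pdh a b g x y z)
      (kx := fun x y => thw t 1 z * pdh (a + 1) b g x y z)
      (ky := fun x y => thw t 1 z * pdh a (b + 1) g x y z)
      (kxy := fun x y => thw t 1 z * pdh (a + 1) (b + 1) g x y z)
      (continuous_const.mul (hk.continuous.comp hl))
      (continuous_const.mul ((hg.pdh _ _).continuous.comp hl))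
      (continuous_const.mul ((hg.pdh _ _).continuous.comp hl))
      (continuous_const.mul ((hg.pdh _ _).continuous.comp hl))
      (fun x y => ?_) (fun x y => ?_) (fun x y => ?_) (a + b) hint x y
    · exact hx ▸ (hk.hasDerivAt_pdx x y z).const_mul _
    · exact hy ▸ (hk.hasDerivAt_pdy x y z).const_mul _
    · exact hxy ▸ ((hg.pdh (a + 1) b).hasDerivAt_pdy x y z).const_mul _

/-- `L^∞_h L²_z` bound for `u^r` with tangential Sobolev loss. -/
theorem LinfhL2z_bound_ur :
    ∀ lam : ℝ, 0 ≤ lam → lam < 1 → ∃ C : ℝ, 0 < C ∧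
      ∀ t : ℝ, 0 ≤ t → ∀ g : ℝ → ℝ → ℝ → ℝ, DecaySmooth g → L2cond t g →
        ∀ n : ℕ,
          (∑ a ∈ Finset.range (n + 1), LIh2z t lam n (pdh a (n - a) (ur t g))) ≤
            C * ((n : ℝ) + 1) ^ 2 *
              ∑ m ∈ Finset.Icc n (n + 2), ∑ a ∈ Finset.range (m + 1),
                L2w t 1 m (pdh a (m - a) g) := by
  intro lam _ hlam
  refine ⟨Real.sqrt (2 + 4 / (1 - lam) ^ 2) * 4, ?_, fun t ht g hg hL n => ?_⟩
  · have : 0 < 1 - lam := by linarith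
    positivity
  have hL0 : ∀ m f, 0 ≤ L2w t 1 m f := fun m f => Real.sqrt_nonneg _
  have hsum : (∑ a ∈ Finset.range (n + 1), LIh2z t lam n (pdh a (n - a) (ur t g))) ≤
      ∑ a ∈ Finset.range (n + 1), Real.sqrt (2 + 4 / (1 - lam) ^ 2) * (2 * ((n : ℝ) + 1)) *
        (L2w t 1 n (pdh a (n - a) g) + L2w t 1 (n + 1) (pdh (a + 1) (n + 1 - (a + 1)) g) +
          L2w t 1 (n + 1) (pdh a (n + 1 - a) g) +
          L2w t 1 (n + 2) (pdh (a + 1) (n + 2 - (a + 1)) g)) := by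
    refine Finset.sum_le_sum fun a ha => ?_
    obtain ⟨b, rfl⟩ := Nat.exists_eq_add_of_le (Nat.lt_succ_iff.1 (Finset.mem_range.1 ha))
    have h := LIh2z_pdh_ur_le hg.1 ht hL hlam a b
    rw [show a + 1 + b = a + b + 1 by ring, show a + (b + 1) = a + b + 1 by ring,
      show a + 1 + (b + 1) = a + b + 2 by ring] at h
    rwa [show a + b - a = b by lia, show a + b + 1 - (a + 1) = b by lia,
      show a + b + 1 - a = b + 1 by lia, show a + b + 2 - (a + 1) = b + 1 by lia]
  refine hsum.trans ?_
  rw [← Finset.mul_sum, Finset.sum_add_distrib, Finset.sum_add_distrib, Finset.sum_add_distrib]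
  set f : ℕ → ℕ → ℝ := fun m a => L2w t 1 m (pdh a (m - a) g) with hf
  have hf0 : ∀ m a, 0 ≤ f m a := fun m a => hL0 _ _
  have hshift : ∀ m j, j ≤ m → (∑ a ∈ Finset.range j, f m (a + 1)) ≤
      ∑ a ∈ Finset.range (m + 1), f m a := by
    intro m j hj
    rw [Finset.sum_range_succ' (f m)]
    refine (Finset.sum_le_sum_of_subset_of_nonneg (Finset.range_mono hj)
      fun a _ _ => hf0 _ _).trans (le_add_of_nonneg_right (hf0 _ _))
  have hrange : (∑ a ∈ Finset.range (n + 1), f (n + 1) a) ≤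
      ∑ a ∈ Finset.range (n + 2), f (n + 1) a :=
    Finset.sum_le_sum_of_subset_of_nonneg (Finset.range_mono (by lia)) fun a _ _ => hf0 _ _
  have hIcc : (∑ m ∈ Finset.Icc n (n + 2), ∑ a ∈ Finset.range (m + 1), f m a) =
      (∑ a ∈ Finset.range (n + 1), f n a) + (∑ a ∈ Finset.range (n + 2), f (n + 1) a) +
        ∑ a ∈ Finset.range (n + 3), f (n + 2) a := by
    rw [Finset.sum_Icc_succ_top (by lia), Finset.sum_Icc_succ_top (by lia), Finset.Icc_self,
      Finset.sum_singleton]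
  have h1 := hshift (n + 1) (n + 1) le_rfl
  have h2 := hshift (n + 2) (n + 1) (by lia)
  have h0 : 0 ≤ ∑ a ∈ Finset.range (n + 1), f n a := Finset.sum_nonneg fun a _ => hf0 _ _
  have h3 : 0 ≤ ∑ a ∈ Finset.range (n + 3), f (n + 2) a := Finset.sum_nonneg fun a _ => hf0 _ _
  have hN : (1 : ℝ) ≤ (n : ℝ) + 1 := by linarith [(Nat.cast_nonneg n : (0 : ℝ) ≤ n)]
  have key : (∑ a ∈ Finset.range (n + 1), f n a) +
        (∑ a ∈ Finset.range (n + 1), f (n + 1) (a + 1)) +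
        (∑ a ∈ Finset.range (n + 1), f (n + 1) a) +
        (∑ a ∈ Finset.range (n + 1), f (n + 2) (a + 1)) ≤
      2 * ∑ m ∈ Finset.Icc n (n + 2), ∑ a ∈ Finset.range (m + 1), f m a := by
    rw [hIcc]
    linarith
  refine (mul_le_mul_of_nonneg_left key (by positivity)).trans ?_
  have hS : 0 ≤ ∑ m ∈ Finset.Icc n (n + 2), ∑ a ∈ Finset.range (m + 1), f m a :=
    Finset.sum_nonneg fun m _ => Finset.sum_nonneg fun a _ => hf0 _ _
  calc _ = Real.sqrt (2 + 4 / (1 - lam) ^ 2) * 4 * ((n : ℝ) + 1) *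
        ∑ m ∈ Finset.Icc n (n + 2), ∑ a ∈ Finset.range (m + 1), f m a := by ring
    _ ≤ _ := by
      gcongr
      exact le_self_pow₀ hN two_ne_zero
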